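/- Let 𝔸 be a countable ω-categorical homogeneous relational structure with no algebraicity which is arsfacere, witnessed by an n-ary relation symbol E. Then for every a ∈ A there exist self-embeddings γ₁, …, γₙ of 𝔸 such that im(γᵢ) ∩ im(γⱼ) = {a} for all i ≠ j, and such that for every endomorphism f of 𝔸 and every b ∈ A ∖ {f(a)} there exists i ∈ {1, …, n} with im(γᵢ) ∩ f⁻¹({b}) = ∅. -/

import Mathlib

open Set

variable {A : Type*} {ι : Type*}

/-- `f` is a homomorphism (endomorphism) of the relational structure `(A, rel)`. -/
def IsHom (ar : ι → ℕ) (rel : ∀ i, (Fin (ar i) → A) → Prop) (f : A → A) : Prop :=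
  ∀ (i : ι) (x : Fin (ar i) → A), rel i x → rel i (f ∘ x)

/-- `f` is a self-embedding of the relational structure `(A, rel)`. -/
def IsEmb (ar : ι → ℕ) (rel : ∀ i, (Fin (ar i) → A) → Prop) (f : A → A) : Prop :=
  Function.Injective f ∧ ∀ (i : ι) (x : Fin (ar i) → A), (rel i x ↔ rel i (f ∘ x))

/-- `f` is an automorphism of the relational structure `(A, rel)`. -/
def IsAuto (ar : ι → ℕ) (rel : ∀ i, (Fin (ar i) → A) → Prop) (f : A → A) : Prop :=
  Function.Bijective f ∧ ∀ (i : ι) (x : Fin (ar i) → A), (rel i x ↔ rel i (f ∘ x))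

/-- `p` is an isomorphism between induced substructures when restricted to `D`. -/
def IsPartialIsoOn (ar : ι → ℕ) (rel : ∀ i, (Fin (ar i) → A) → Prop)
    (D : Set A) (p : A → A) : Prop :=
  Set.InjOn p D ∧
    ∀ (i : ι) (x : Fin (ar i) → A), (∀ k, x k ∈ D) → (rel i x ↔ rel i (p ∘ x))

/-- `p` is a homomorphism between induced substructures when restricted to `D`. -/
def IsPartialHomOn (ar : ι → ℕ) (rel : ∀ i, (Fin (ar i) → A) → Prop)
    (D : Set A) (p : A → A) : Prop :=
  ∀ (i : ι) (x : Fin (ar i) → A), (∀ k, x k ∈ D) → rel i x → rel i (p ∘ x)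

/-- Every isomorphism between finite induced substructures extends to an automorphism. -/
def Homogeneous (ar : ι → ℕ) (rel : ∀ i, (Fin (ar i) → A) → Prop) : Prop :=
  ∀ (D : Finset A) (p : A → A), IsPartialIsoOn ar rel ↑D p →
    ∃ g : A → A, IsAuto ar rel g ∧ ∀ a ∈ D, g a = p a

/-- Every orbit on `A \ F` of the pointwise stabiliser of a finite set `F` is infinite. -/
def NoAlgebraicity (ar : ι → ℕ) (rel : ∀ i, (Fin (ar i) → A) → Prop) : Prop :=
  ∀ (F : Finset A) (a : A), a ∉ F →
    {b : A | ∃ g : A → A, IsAuto ar rel g ∧ (∀ x ∈ F, g x = x) ∧ g a = b}.Infinite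

/-- For every `k`, the action of the automorphism group on `k`-tuples has
finitely many orbits. -/
def OmegaCategorical (ar : ι → ℕ) (rel : ∀ i, (Fin (ar i) → A) → Prop) : Prop :=
  ∀ k : ℕ,
    (Set.range fun v : Fin k → A =>
      {w : Fin k → A | ∃ g : A → A, IsAuto ar rel g ∧ w = g ∘ v}).Finite

/-- The endomorphisms of `(A, rel)`, as a set of functions. -/
def endSet (ar : ι → ℕ) (rel : ∀ i, (Fin (ar i) → A) → Prop) : Set (A → A) :=
  {f : A → A | IsHom ar rel f}

/-- The self-embeddings of `(A, rel)`, as a set of functions. -/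
def embSet (ar : ι → ℕ) (rel : ∀ i, (Fin (ar i) → A) → Prop) : Set (A → A) :=
  {f : A → A | IsEmb ar rel f}

/-- The automorphisms of `(A, rel)`, as a set of functions. -/
def autSet (ar : ι → ℕ) (rel : ∀ i, (Fin (ar i) → A) → Prop) : Set (A → A) :=
  {f : A → A | IsAuto ar rel f}

/-- `(A, rel)` is arsfacere, witnessed by the relation symbol `E`. -/
def ArsfacereWith (ar : ι → ℕ) (rel : ∀ i, (Fin (ar i) → A) → Prop) (E : ι) : Prop :=
  (∀ x : A, ¬ rel E (fun _ => x)) ∧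
  ∀ (x : A) (F : Fin (ar E) → Finset A),
    (∀ i j : Fin (ar E), i ≠ j → ((F i : Set A) ∩ (F j : Set A)) = {x}) →
    ∃ f : A → A,
      Set.InjOn f (⋃ i, (F i : Set A)) ∧
      (∀ i, IsPartialIsoOn ar rel (F i : Set A) f) ∧
      ∀ y : Fin (ar E) → A, (∀ k, y k ∈ F k ∧ y k ≠ x) →
        ∃ σ : Equiv.Perm (Fin (ar E)), rel E (fun k => f (y (σ k)))

section Automorphisms

variable {ar : ι → ℕ} {rel : ∀ i, (Fin (ar i) → A) → Prop}

theorem IsAuto.id : IsAuto ar rel (id : A → A) :=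
  ⟨Function.bijective_id, fun _ _ => Iff.rfl⟩

theorem IsAuto.comp {g h : A → A} (hg : IsAuto ar rel g) (hh : IsAuto ar rel h) :
    IsAuto ar rel (g ∘ h) :=
  ⟨hg.1.comp hh.1, fun i x => (hh.2 i x).trans (hg.2 i (h ∘ x))⟩

theorem IsAuto.exists_inverse {g : A → A} (hg : IsAuto ar rel g) :
    ∃ h : A → A, IsAuto ar rel h ∧ (∀ x, h (g x) = x) ∧ ∀ x, g (h x) = x := by
  let e := Equiv.ofBijective g hg.1
  refine ⟨e.symm, ⟨e.symm.bijective, fun i x => ?_⟩, e.symm_apply_apply, e.apply_symm_apply⟩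
  have hx : g ∘ e.symm ∘ x = x := funext fun k => e.apply_symm_apply (x k)
  rw [hg.2 i (e.symm ∘ x), hx]

theorem IsAuto.isEmb {g : A → A} (hg : IsAuto ar rel g) : IsEmb ar rel g :=
  ⟨hg.1.injective, hg.2⟩

theorem IsEmb.comp {g h : A → A} (hg : IsEmb ar rel g) (hh : IsEmb ar rel h) :
    IsEmb ar rel (g ∘ h) :=
  ⟨hg.1.comp hh.1, fun i x => (hh.2 i x).trans (hg.2 i (h ∘ x))⟩

/-- A map is a self-embedding if on every finite set it agrees with a partial isomorphism. -/
theorem IsEmb.of_forall_finset {f : A → A}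
    (h : ∀ D : Finset A, ∃ p : A → A, IsPartialIsoOn ar rel ↑D p ∧ ∀ x ∈ D, f x = p x) :
    IsEmb ar rel f := by
  classical
  constructor
  · intro x y hxy
    obtain ⟨p, hp, hfp⟩ := h {x, y}
    refine hp.1 (by simp) (by simp) ?_
    rw [← hfp x (by simp), ← hfp y (by simp), hxy]
  · intro i x
    obtain ⟨p, hp, hfp⟩ := h (Finset.univ.image x)
    have hx : f ∘ x = p ∘ x := funext fun k => hfp _ (by simp)
    rw [hx]
    exact hp.2 i x fun k => by simp

/-- Without algebraicity, a finite set can be moved away from another finite set by an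
automorphism fixing a given disjoint finite set pointwise. -/
theorem NoAlgebraicity.exists_forall_notMem (noalg : NoAlgebraicity ar rel)
    (F B D : Finset A) (hD : ∀ x ∈ D, x ∉ F) :
    ∃ g : A → A, IsAuto ar rel g ∧ (∀ x ∈ F, g x = x) ∧ ∀ x ∈ D, g x ∉ B := by
  classical
  induction D using Finset.induction_on with
  | empty => exact ⟨id, IsAuto.id, by simp, by simp⟩
  | insert d D hd ih =>
    obtain ⟨g, hg, hgF, hgD⟩ := ih fun x hx => hD x (Finset.mem_insert_of_mem hx)
    have hgd : g d ∉ F ∪ D.image g := by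
      intro hmem
      rcases Finset.mem_union.1 hmem with hF | hI
      · have : g d = d := hg.1.injective (hgF _ hF)
        exact hD d (Finset.mem_insert_self d D) (this ▸ hF)
      · obtain ⟨y, hy, hyd⟩ := Finset.mem_image.1 hI
        exact hd (hg.1.injective hyd ▸ hy)
    obtain ⟨b, ⟨h, hh, hfix, rfl⟩, hb⟩ := (noalg _ _ hgd).exists_notMem_finset B
    refine ⟨h ∘ g, hh.comp hg, fun x hx => ?_, fun x hx => ?_⟩
    · simp only [Function.comp_apply, hgF x hx]
      exact hfix x (Finset.mem_union_left _ hx)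
    · rcases Finset.mem_insert.1 hx with rfl | hx
      · exact hb
      · simp only [Function.comp_apply,
          hfix (g x) (Finset.mem_union_right _ (Finset.mem_image_of_mem g hx))]
        exact hgD x hx

/-- Without algebraicity, there are infinitely many automorphic copies of a finite set that
pairwise meet only in a prescribed point. -/
theorem NoAlgebraicity.exists_seq_disjoint (noalg : NoAlgebraicity ar rel)
    (a : A) (D : Finset A) :
    ∃ g : ℕ → A → A, (∀ i, IsAuto ar rel (g i) ∧ g i a = a) ∧
      ∀ i j, i ≠ j → ∀ x ∈ D, ∀ y ∈ D, x ≠ a → g i x ≠ g j y := by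
  classical
  obtain ⟨g, hg, hlt⟩ := exists_seq_of_forall_finset_exists
    (fun g : A → A => IsAuto ar rel g ∧ g a = a)
    (fun g h => ∀ x ∈ D, ∀ y ∈ D, y ≠ a → g x ≠ h y) (by
      intro s hs
      obtain ⟨g, hg, hga, hgD⟩ := noalg.exists_forall_notMem {a}
        (s.biUnion fun h => D.image h) (D.erase a) (by simp +contextual)
      refine ⟨g, ⟨hg, hga a (by simp)⟩, fun h hh x hx y hy hya hxy => ?_⟩
      refine hgD y (Finset.mem_erase.2 ⟨hya, hy⟩) (Finset.mem_biUnion.2 ⟨h, hh, ?_⟩)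
      exact Finset.mem_image.2 ⟨x, hx, hxy⟩)
  refine ⟨g, hg, fun i j hij x hx y hy hxa hxy => ?_⟩
  rcases lt_or_gt_of_ne hij with h | h
  · have hya : y ≠ a := by
      rintro rfl
      exact hxa ((hg i).1.1.injective (by rw [hxy, (hg i).2, (hg j).2]))
    exact hlt i j h x hx y hy hya hxy
  · exact hlt j i h y hy x hx hxa hxy.symm

theorem Ultrafilter.exists_eventually_eq_of_finite_range {K C : Type*} (U : Ultrafilter K)
    {c : K → C} (hc : (Set.range c).Finite) : ∃ k₀, ∀ᶠ k in (U : Filter K), c k = c k₀ := by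
  have h : ∀ᶠ k in (U : Filter K), ∃ o ∈ Set.range c, c k = o :=
    Filter.Eventually.of_forall fun k => ⟨c k, ⟨k, rfl⟩, rfl⟩
  obtain ⟨_, ⟨k₀, rfl⟩, h⟩ := (U.eventually_exists_mem_iff hc).1 h
  exact ⟨k₀, h⟩

/-- Compactness for sequences modulo automorphisms of an ω-categorical structure. -/
theorem OmegaCategorical.exists_limit_nat (omcat : OmegaCategorical ar rel)
    {K : Type*} (U : Ultrafilter K) (s : K → ℕ → A) :
    ∃ t : ℕ → A, ∀ m, ∀ᶠ k in (U : Filter K),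
      ∃ g : A → A, IsAuto ar rel g ∧ ∀ j < m, t j = g (s k j) := by
  have hrep : ∀ m : ℕ, ∃ k₀ : K, ∀ᶠ k in (U : Filter K),
      ∃ g : A → A, IsAuto ar rel g ∧ ∀ j < m, s k₀ j = g (s k j) := by
    intro m
    obtain ⟨k₀, hk₀⟩ := U.exists_eventually_eq_of_finite_range
      (c := fun k => {w : Fin m → A | ∃ g : A → A, IsAuto ar rel g ∧
        w = g ∘ fun l : Fin m => s k l})
      ((omcat m).subset (by rintro _ ⟨k, rfl⟩; exact ⟨fun l => s k l, rfl⟩))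
    refine ⟨k₀, hk₀.mono fun k hk => ?_⟩
    have hmem : (fun l : Fin m => s k₀ l) ∈ {w : Fin m → A | ∃ g : A → A, IsAuto ar rel g ∧
        w = g ∘ fun l : Fin m => s k l} := hk ▸ ⟨id, IsAuto.id, rfl⟩
    obtain ⟨g, hg, hgk⟩ := hmem
    exact ⟨g, hg, fun j hj => congrFun hgk ⟨j, hj⟩⟩
  choose r hr using hrep
  have hstep : ∀ m, ∃ g : A → A, IsAuto ar rel g ∧ ∀ j < m, g (s (r (m + 1)) j) = s (r m) j := by
    intro m
    obtain ⟨k, ⟨g, hg, hgk⟩, ⟨h, hh, hhk⟩⟩ := ((hr m).and (hr (m + 1))).exists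
    obtain ⟨h', hh', hl, -⟩ := hh.exists_inverse
    refine ⟨g ∘ h', hg.comp hh', fun j hj => ?_⟩
    simp only [Function.comp_apply]
    rw [hhk j (by omega), hl, hgk j hj]
  choose g hg hgs using hstep
  let H : ℕ → A → A := fun m => Nat.rec id (fun m h => h ∘ g m) m
  have hH : ∀ m, IsAuto ar rel (H m) := by
    intro m
    induction m with
    | zero => exact IsAuto.id
    | succ m ih => exact ih.comp (hg m)
  have hHs : ∀ m, ∀ j < m, H (j + 1) (s (r (j + 1)) j) = H m (s (r m) j) := by
    intro m
    induction m with
    | zero => intro j hj; omega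
    | succ m ih =>
      intro j hj
      rcases Nat.lt_succ_iff_lt_or_eq.1 hj with hj | rfl
      · rw [ih j hj, ← hgs m j hj]
        rfl
      · rfl
  refine ⟨fun j => H (j + 1) (s (r (j + 1)) j), fun m => (hr m).mono ?_⟩
  rintro k ⟨h, hh, hhk⟩
  refine ⟨H m ∘ h, (hH m).comp hh, fun j hj => ?_⟩
  exact (hHs m j hj).trans (congrArg (H m) (hhk j hj))

/-- Compactness for families with countable index set, modulo automorphisms of an
ω-categorical structure. -/
theorem OmegaCategorical.exists_limit (omcat : OmegaCategorical ar rel)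
    {J K : Type*} [Countable J] [Nonempty J] (U : Ultrafilter K) (s : K → J → A) :
    ∃ t : J → A, ∀ S : Finset J, ∀ᶠ k in (U : Filter K),
      ∃ g : A → A, IsAuto ar rel g ∧ ∀ j ∈ S, t j = g (s k j) := by
  obtain ⟨e, he⟩ := exists_surjective_nat J
  obtain ⟨t, ht⟩ := omcat.exists_limit_nat U fun k l => s k (e l)
  let e' := Function.surjInv he
  refine ⟨t ∘ e', fun S => (ht (S.sup e' + 1)).mono ?_⟩
  rintro k ⟨g, hg, hgk⟩
  refine ⟨g, hg, fun j hj => ?_⟩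
  have := hgk (e' j) (Nat.lt_succ_of_le (Finset.le_sup hj))
  rwa [Function.surjInv_eq he] at this

/-- The finite approximations of the embeddings: copies of a finite set that meet only in the
copy of `a` and whose transversals avoiding that point are, up to permutation, in `E`. -/
theorem ArsfacereWith.exists_partialIso {E : ι} (ars : ArsfacereWith ar rel E)
    (noalg : NoAlgebraicity ar rel) (a : A) (D : Finset A) (ha : a ∈ D) :
    ∃ s : Fin (ar E) → A → A,
      (∀ i, IsPartialIsoOn ar rel ↑D (s i)) ∧
      (∀ i j, s i a = s j a) ∧
      (∀ i j, i ≠ j → ∀ x ∈ D, ∀ y ∈ D, x ≠ a → s i x ≠ s j y) ∧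
      ∀ y : Fin (ar E) → A, (∀ k, y k ∈ D ∧ y k ≠ a) →
        ∃ σ : Equiv.Perm (Fin (ar E)), rel E (fun k => s (σ k) (y (σ k))) := by
  classical
  obtain ⟨g, hg, hdisj⟩ := noalg.exists_seq_disjoint a D
  obtain ⟨f, hf, hiso, hE⟩ := ars.2 a (fun i => D.image (g i)) (by
    intro i j hij
    ext z
    simp only [Finset.coe_image, Set.mem_inter_iff, Set.mem_image, Finset.mem_coe,
      Set.mem_singleton_iff]
    constructor
    · rintro ⟨⟨x, hx, rfl⟩, y, hy, hxy⟩
      by_contra hne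
      refine hdisj i j (by omega) x hx y hy ?_ hxy.symm
      rintro rfl
      exact hne (hg i).2
    · rintro rfl
      exact ⟨⟨z, ha, (hg i).2⟩, z, ha, (hg j).2⟩)
  have hmem : ∀ (i : Fin (ar E)) {x}, x ∈ D → g i x ∈ D.image (g i) :=
    fun i x hx => Finset.mem_image_of_mem _ hx
  have hmemU : ∀ (i : Fin (ar E)) {x}, x ∈ D →
      g i x ∈ ⋃ i : Fin (ar E), ((D.image (g i) : Finset A) : Set A) :=
    fun i x hx => Set.mem_iUnion.2 ⟨i, hmem i hx⟩
  refine ⟨fun i => f ∘ g i, fun i => ⟨?_, fun l x hx => ?_⟩, fun i j => ?_, ?_, fun y hy => ?_⟩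
  · intro x hx y hy hxy
    exact (hg i).1.1.injective (hf (hmemU i hx) (hmemU i hy) hxy)
  · exact ((hg i).1.2 l x).trans ((hiso i).2 l (g i ∘ x) fun k => hmem i (hx k))
  · simp only [Function.comp_apply, (hg i).2, (hg j).2]
  · intro i j hij x hx y hy hxa hxy
    exact hdisj i j (by omega) x hx y hy hxa (hf (hmemU i hx) (hmemU j hy) hxy)
  · exact hE (fun k => g k (y k)) fun k => ⟨hmem k (hy k).1, fun h =>
      (hy k).2 ((hg k).1.1.injective (h.trans (hg k).2.symm))⟩

/-- There are self-embeddings meeting only in `a` whose transversals avoiding `a` are, up to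
permutation, in `E`. -/
theorem ArsfacereWith.exists_isEmb [Countable A] {E : ι} (ars : ArsfacereWith ar rel E)
    (omcat : OmegaCategorical ar rel) (homog : Homogeneous ar rel)
    (noalg : NoAlgebraicity ar rel) (a : A) :
    ∃ γ : Fin (ar E) → A → A,
      (∀ i, IsEmb ar rel (γ i)) ∧ (∀ i, γ i a = a) ∧
      (∀ i j, i ≠ j → ∀ x y, x ≠ a → γ i x ≠ γ j y) ∧
      ∀ y : Fin (ar E) → A, (∀ k, y k ≠ a) →
        ∃ σ : Equiv.Perm (Fin (ar E)), rel E (fun k => γ (σ k) (y (σ k))) := by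
  classical
  rcases isEmpty_or_nonempty (Fin (ar E)) with hempty | ⟨⟨i₀⟩⟩
  · obtain ⟨f, -, -, hE⟩ := ars.2 a (fun _ => ∅) fun i => hempty.elim i
    obtain ⟨σ, h⟩ := hE (fun _ => a) fun k => hempty.elim k
    refine absurd h ?_
    convert ars.1 a using 2
  have : Nonempty (Fin (ar E) × A) := ⟨(i₀, a)⟩
  choose s hiso hbase hne hE using fun D : Finset A =>
    ars.exists_partialIso noalg a (insert a D) (Finset.mem_insert_self a D)
  obtain ⟨t, ht⟩ := omcat.exists_limit (Ultrafilter.of Filter.atTop)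
    fun (D : Finset A) (p : Fin (ar E) × A) => s D p.1 p.2
  have hlim : ∀ D : Finset A, ∃ D' : Finset A, D ⊆ D' ∧ ∃ g, IsAuto ar rel g ∧
      ∀ i, ∀ x ∈ D, t (i, x) = g (s D' i x) := by
    intro D
    obtain ⟨D', hD', g, hg, hgt⟩ :=
      (((Filter.eventually_ge_atTop D).filter_mono (Ultrafilter.of_le _)).and
        (ht (Finset.univ ×ˢ D))).exists
    exact ⟨D', hD', g, hg, fun i x hx => hgt (i, x) (by simp [hx])⟩
  have hemb : ∀ i, IsEmb ar rel fun x => t (i, x) := by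
    intro i
    refine IsEmb.of_forall_finset fun D => ?_
    obtain ⟨D', hD, g, hg, hgt⟩ := hlim D
    have hsub : ∀ x ∈ (D : Set A), x ∈ ((insert a D' : Finset A) : Set A) :=
      fun x hx => Finset.mem_insert_of_mem (hD hx)
    refine ⟨g ∘ s D' i, ⟨?_, fun l x hx => ?_⟩, fun x hx => hgt i x hx⟩
    · exact hg.1.injective.comp_injOn ((hiso D' i).1.mono hsub)
    · exact ((hiso D' i).2 l x fun k => hsub _ (hx k)).trans (hg.2 l _)
  have htbase : ∀ i, t (i, a) = t (i₀, a) := by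
    intro i
    obtain ⟨D', -, g, -, hgt⟩ := hlim {a}
    rw [hgt i a (by simp), hgt i₀ a (by simp), hbase D' i i₀]
  obtain ⟨g, hg, hga⟩ := homog {a} (fun x => t (i₀, x))
    ⟨(hemb i₀).1.injOn, fun l x _ => (hemb i₀).2 l x⟩
  obtain ⟨h, hh, hhg, -⟩ := hg.exists_inverse
  refine ⟨fun i => h ∘ fun x => t (i, x), fun i => hh.isEmb.comp (hemb i), fun i => ?_, ?_, ?_⟩
  · change h (t (i, a)) = a
    rw [htbase i, ← hga a (by simp), hhg]
  · intro i j hij x y hxa hxy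
    obtain ⟨D', hD, g', hg', hgt⟩ := hlim {x, y}
    have hxy' : t (i, x) = t (j, y) := hh.1.injective hxy
    rw [hgt i x (by simp), hgt j y (by simp)] at hxy'
    exact hne D' i j hij x (Finset.mem_insert_of_mem (hD (by simp))) y
      (Finset.mem_insert_of_mem (hD (by simp))) hxa (hg'.1.injective hxy')
  · intro y hy
    obtain ⟨D', hD, g', hg', hgt⟩ := hlim (Finset.univ.image y)
    obtain ⟨σ, hσ⟩ := hE D' y fun k =>
      ⟨Finset.mem_insert_of_mem (hD (Finset.mem_image_of_mem y (Finset.mem_univ k))), hy k⟩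
    refine ⟨σ, ?_⟩
    have := (hh.2 E _).1 ((hg'.2 E _).1 hσ)
    convert this using 2 with k
    exact congrArg h (hgt (σ k) (y (σ k)) (Finset.mem_image_of_mem y (Finset.mem_univ _)))

end Automorphisms

theorem exists_embeddings_arsfacere
    [Countable A]
    (ar : ι → ℕ) (rel : ∀ i, (Fin (ar i) → A) → Prop) (E : ι)
    (omcat : OmegaCategorical ar rel)
    (homog : Homogeneous ar rel)
    (noalg : NoAlgebraicity ar rel)
    (ars : ArsfacereWith ar rel E)
    (a : A) :
    ∃ γ : Fin (ar E) → (A → A),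
      (∀ i, IsEmb ar rel (γ i)) ∧
      (∀ i j : Fin (ar E), i ≠ j →
        Set.range (γ i) ∩ Set.range (γ j) = {a}) ∧
      ∀ f : A → A, IsHom ar rel f → ∀ b : A, b ≠ f a →
        ∃ i : Fin (ar E), Set.range (γ i) ∩ f ⁻¹' {b} = ∅ := by
  obtain ⟨γ, hemb, hbase, hne, hE⟩ := ars.exists_isEmb omcat homog noalg a
  refine ⟨γ, hemb, fun i j hij => ?_, fun f hf b hb => ?_⟩
  · refine Set.Subset.antisymm ?_ (Set.singleton_subset_iff.2 ⟨⟨a, hbase i⟩, a, hbase j⟩)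
    rintro _ ⟨⟨x, rfl⟩, y, hxy⟩
    by_contra hxa
    refine hne i j hij x y ?_ hxy.symm
    rintro rfl
    exact hxa (hbase i)
  · by_contra! hcon
    have hpre : ∀ i, ∃ y, f (γ i y) = b := by
      intro i
      obtain ⟨_, ⟨y, rfl⟩, hy⟩ := hcon i
      exact ⟨y, hy⟩
    choose y hy using hpre
    obtain ⟨σ, hσ⟩ := hE y fun k hk => hb (by rw [← hy k, hk, hbase k])
    refine ars.1 b ?_
    convert hf E _ hσ using 2 with k
    exact (hy (σ k)).symm
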